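/- arXiv:1110.0366 — 5 statements merged into one kernel-verified Lean document; each statement's English description precedes it below -/
import Mathlib

section
/- Let f ∈ ℂ[x,y] be squarefree and homogeneous of degree k ≥ 3. Then the ℂ-vector space ℂ[x,y]_k / (J(f) ∩ ℂ[x,y]_k) has dimension k − 3 (hence the space FT¹ of infinitesimal admissible deformations of the germ of the free divisor D = V(f) ⊂ ℂ² has dimension k − 3). -/
open MvPolynomial

namespace MvPolynomial

theorem finrank_homogeneousSubmodule (σ K : Type*) [Fintype σ] [Field K] (n : ℕ) :
    Module.finrank K (homogeneousSubmodule σ K n) = (Fintype.card σ).multichoose n := by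
  classical
  rw [homogeneousSubmodule_eq_finsupp_supported]
  have hset : {d : σ →₀ ℕ | d.degree = n} =
      (Finset.finsuppAntidiag (Finset.univ : Finset σ) n : Set (σ →₀ ℕ)) := by
    ext d
    simp [Finsupp.degree_eq_sum]
  rw [hset, LinearEquiv.finrank_eq (AddMonoidAlgebra.supportedEquivFinsupp _),
    Module.finrank_finsupp_self]
  simp [Finset.card_finsuppAntidiag_nat_eq_multichoose]

theorem totalDegree_pderiv_lt {σ R : Type*} [CommSemiring R] {p : MvPolynomial σ R} {i : σ}
    (h : pderiv i p ≠ 0) : (pderiv i p).totalDegree < p.totalDegree := by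
  obtain ⟨m, hm, hdeg⟩ := Finset.exists_mem_eq_sup _ (support_nonempty.mpr h)
    (fun s : σ →₀ ℕ ↦ s.degree)
  have hmem : m + Finsupp.single i 1 ∈ p.support := by
    rw [mem_support_iff, coeff_pderiv] at hm
    exact mem_support_iff.mpr (left_ne_zero_of_mul hm)
  have hle := le_totalDegree hmem
  change (m + Finsupp.single i 1).degree ≤ _ at hle
  change (pderiv i p).totalDegree = _ at hdeg
  rw [map_add, Finsupp.degree_single] at hle
  lia

theorem pderiv_eq_zero_of_dvd {σ R : Type*} [CommRing R] [IsDomain R] {p : MvPolynomial σ R}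
    {i : σ} (h : p ∣ pderiv i p) : pderiv i p = 0 := by
  by_contra h0
  exact (totalDegree_pderiv_lt h0).not_ge (totalDegree_le_of_dvd_of_isDomain h h0)

theorem eq_C_of_forall_pderiv_eq_zero {σ R : Type*} [CommRing R] [IsDomain R] [CharZero R]
    {p : MvPolynomial σ R} (h : ∀ i, pderiv i p = 0) : p = C (coeff 0 p) := by
  classical
  ext m
  rw [coeff_C]
  split_ifs with hm
  · rw [hm]
  obtain ⟨i, hi⟩ := Finsupp.ne_iff.mp (Ne.symm hm)
  have hle : Finsupp.single i 1 ≤ m := by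
    simpa [Nat.one_le_iff_ne_zero] using hi
  have hc := coeff_pderiv (i := i) p (m - Finsupp.single i 1)
  rw [h i, coeff_zero, tsub_add_cancel_of_le hle] at hc
  exact (mul_eq_zero.mp hc.symm).resolve_right (Nat.cast_add_one_ne_zero _)

theorem isUnit_of_forall_dvd_pderiv {σ K : Type*} [Field K] [CharZero K]
    {p : MvPolynomial σ K} (hp : p ≠ 0) (h : ∀ i, p ∣ pderiv i p) : IsUnit p := by
  have hC := eq_C_of_forall_pderiv_eq_zero fun i ↦ pderiv_eq_zero_of_dvd (h i)
  rw [hC] at hp ⊢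
  exact (isUnit_iff_ne_zero.mpr fun h0 ↦ hp (by rw [h0, C_0])).map C

/-- In characteristic zero, an irreducible polynomial dividing `f` and all its partial derivatives
is a multiple factor of `f`. -/
theorem _root_.Squarefree.exists_not_dvd_pderiv {σ K : Type*} [Field K] [CharZero K]
    {f p : MvPolynomial σ K} (hf : Squarefree f) (hp : Irreducible p) (hpf : p ∣ f) :
    ∃ i, ¬ p ∣ pderiv i f := by
  by_contra! h
  obtain ⟨g, rfl⟩ := hpf
  have hpg : ¬ p ∣ g := fun hg ↦ hp.not_isUnit (hf p (mul_dvd_mul_left p hg))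
  refine hp.not_isUnit (isUnit_of_forall_dvd_pderiv hp.ne_zero fun i ↦ ?_)
  have hi := h i
  rw [pderiv_mul, dvd_add_left (dvd_mul_right _ _)] at hi
  exact (hp.prime.dvd_or_dvd hi).resolve_right hpg

theorem IsHomogeneous.isRelPrime_pderiv {K : Type*} [Field K] [CharZero K]
    {f : MvPolynomial (Fin 2) K} {k : ℕ} (hf : f.IsHomogeneous k) (hk : k ≠ 0)
    (hsq : Squarefree f) : IsRelPrime (pderiv 0 f) (pderiv 1 f) := by
  have euler := hf.sum_X_mul_pderiv
  rw [Fin.sum_univ_two, ← Nat.cast_smul_eq_nsmul K] at euler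
  have hk' : (k : K) ≠ 0 := Nat.cast_ne_zero.mpr hk
  refine WfDvdMonoid.isRelPrime_of_no_irreducible_factors ?_ fun p hp h0 h1 ↦ ?_
  · rintro ⟨h0, h1⟩
    rw [h0, h1, mul_zero, mul_zero, add_zero] at euler
    exact hsq.ne_zero ((smul_eq_zero.mp euler.symm).resolve_left hk')
  · have hpf : p ∣ f := by
      have hd : p ∣ (k : K) • f := euler ▸ dvd_add (h0.mul_left _) (h1.mul_left _)
      simpa [smul_smul, inv_mul_cancel₀ hk'] using dvd_smul_of_dvd ((k : K)⁻¹) hd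
    obtain ⟨i, hi⟩ := hsq.exists_not_dvd_pderiv hp hpf
    fin_cases i
    exacts [hi h0, hi h1]

/-- A relatively prime pair of forms of degree `m` has no syzygies in degree `n < m`. -/
theorem IsHomogeneous.eq_zero_of_mul_add_mul_eq_zero {σ K : Type*} [Field K]
    {a b g h : MvPolynomial σ K} {m n : ℕ} (hb : b.IsHomogeneous n)
    (hg : g.IsHomogeneous m) (hnm : n < m) (hgh : IsRelPrime g h) (H : a * g + b * h = 0) :
    b = 0 := by
  by_contra hb0
  have hdvd : g ∣ b := by
    refine hgh.dvd_of_dvd_mul_right ⟨-a, ?_⟩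
    linear_combination H
  have hg0 : g ≠ 0 := ne_zero_of_dvd_ne_zero hb0 hdvd
  have hle := totalDegree_le_of_dvd_of_isDomain hdvd hb0
  rw [hg.totalDegree hg0, hb.totalDegree hb0] at hle
  lia

/-- The map `(a, b) ↦ a * g + b * h` on pairs of forms of degree `n`. -/
noncomputable def homogeneousMulAddMul {σ K : Type*} [Field K] {g h : MvPolynomial σ K} {m : ℕ}
    (hg : g.IsHomogeneous m) (hh : h.IsHomogeneous m) (n : ℕ) :
    (homogeneousSubmodule σ K n × homogeneousSubmodule σ K n) →ₗ[K]
      homogeneousSubmodule σ K (n + m) :=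
  LinearMap.codRestrict _
    (((LinearMap.mulRight K g).comp (homogeneousSubmodule σ K n).subtype).coprod
      ((LinearMap.mulRight K h).comp (homogeneousSubmodule σ K n).subtype))
    fun x ↦ (x.1.2.mul hg).add (x.2.2.mul hh)

theorem coe_homogeneousMulAddMul {σ K : Type*} [Field K] {g h : MvPolynomial σ K} {m : ℕ}
    (hg : g.IsHomogeneous m) (hh : h.IsHomogeneous m) (n : ℕ)
    (x : homogeneousSubmodule σ K n × homogeneousSubmodule σ K n) :
    (homogeneousMulAddMul hg hh n x : MvPolynomial σ K) = x.1 * g + x.2 * h := rfl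

theorem homogeneousMulAddMul_injective {σ K : Type*} [Field K] {g h : MvPolynomial σ K}
    {m n : ℕ} (hg : g.IsHomogeneous m) (hh : h.IsHomogeneous m) (hnm : n < m)
    (hgh : IsRelPrime g h) : Function.Injective (homogeneousMulAddMul hg hh n) := by
  rw [← LinearMap.ker_eq_bot, LinearMap.ker_eq_bot']
  rintro ⟨⟨a, ha⟩, ⟨b, hb⟩⟩ H
  have H' : a * g + b * h = 0 := congrArg Subtype.val H
  obtain rfl := IsHomogeneous.eq_zero_of_mul_add_mul_eq_zero hb hg hnm hgh H'
  obtain rfl := IsHomogeneous.eq_zero_of_mul_add_mul_eq_zero ha hh hnm hgh.symm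
    ((add_comm _ _).trans H')
  rfl

theorem range_homogeneousMulAddMul {σ K : Type*} [Field K] {g h : MvPolynomial σ K} {m : ℕ}
    (hg : g.IsHomogeneous m) (hh : h.IsHomogeneous m) (n : ℕ) :
    LinearMap.range (homogeneousMulAddMul hg hh n) =
      ((Ideal.span {g, h}).restrictScalars K).comap
        (homogeneousSubmodule σ K (n + m)).subtype := by
  let _ : GradedAlgebra (homogeneousSubmodule σ K) := gradedAlgebra
  ext ⟨p, hp⟩
  simp only [LinearMap.mem_range, Submodule.mem_comap, Submodule.subtype_apply,
    Submodule.restrictScalars_mem, Ideal.mem_span_pair]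
  constructor
  · rintro ⟨x, hx⟩
    exact ⟨x.1, x.2, congrArg Subtype.val hx⟩
  · rintro ⟨u, v, huv⟩
    have key : ∀ w q : MvPolynomial σ K, q.IsHomogeneous m →
        (DirectSum.decompose (homogeneousSubmodule σ K) (w * q) (n + m) : MvPolynomial σ K) =
          DirectSum.decompose (homogeneousSubmodule σ K) w n * q := fun w q hq ↦ by
      rw [DirectSum.coe_decompose_mul_of_right_mem_of_le (homogeneousSubmodule σ K) hq
        (Nat.le_add_left m n), Nat.add_sub_cancel]
    refine ⟨(DirectSum.decompose (homogeneousSubmodule σ K) u n,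
      DirectSum.decompose (homogeneousSubmodule σ K) v n), Subtype.ext ?_⟩
    rw [coe_homogeneousMulAddMul, ← key u g hg, ← key v h hh, ← Submodule.coe_add,
      ← DirectSum.add_apply, ← DirectSum.decompose_add, huv]
    exact DirectSum.decompose_of_mem_same _ hp

end MvPolynomial

/-- For a squarefree homogeneous `f ∈ ℂ[x,y]` of degree `k ≥ 3`, the space
`ℂ[x,y]_k / (J(f) ∩ ℂ[x,y]_k)` has dimension `k − 3`; hence `FT¹(V(f))` has dimension
`k − 3`. -/
theorem finrank_FT1_plane_curve
    (k : ℕ) (hk : 3 ≤ k) (f : MvPolynomial (Fin 2) ℂ)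
    (hsq : Squarefree f) (hhom : f.IsHomogeneous k) :
    Module.finrank ℂ
      ((homogeneousSubmodule (Fin 2) ℂ k) ⧸
        (((Ideal.span {pderiv 0 f, pderiv 1 f}).restrictScalars ℂ).comap
          (homogeneousSubmodule (Fin 2) ℂ k).subtype)) = k - 3 := by
  obtain ⟨m, rfl⟩ : ∃ m, k = 1 + m := ⟨k - 1, by lia⟩
  have hd (i : Fin 2) : (pderiv i f).IsHomogeneous m := by simpa using hhom.pderiv (i := i)
  have hfin (n : ℕ) : Module.Finite ℂ (homogeneousSubmodule (Fin 2) ℂ n) :=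
    Module.Finite.iff_fg.mpr (homogeneousSubmodule_fg _ _ n)
  have hinj := homogeneousMulAddMul_injective (hd 0) (hd 1) (n := 1) (by lia)
    (hhom.isRelPrime_pderiv (by lia) hsq)
  have hrange := LinearMap.finrank_range_of_inj hinj
  have hquot := Submodule.finrank_quotient_add_finrank
    (LinearMap.range (homogeneousMulAddMul (hd 0) (hd 1) 1))
  rw [hrange, Module.finrank_prod, finrank_homogeneousSubmodule, finrank_homogeneousSubmodule,
    Fintype.card_fin, Nat.multichoose_two, Nat.multichoose_two,
    range_homogeneousMulAddMul] at hquot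
  lia
end

section
/- Let a : Fin n → Fin n → R and define the derivations δᵢ := ∑ⱼ (a i j) • ∂/∂xⱼ for i = 1,…,n (relative vector fields, having no ∂/∂tₗ components). Assume the δᵢ are closed under bracket: ⁅δᵢ,δⱼ⁆ ∈ Submodule.span R {δ₁,…,δₙ} for all i,j. Let h := det of the n×n matrix (a i j). Then δₖ(h) ∈ Ideal.span {h} for every k. -/
open MvPolynomial

theorem Derivation.finset_sum_apply {ι R A M : Type*} [CommSemiring R] [CommSemiring A]
    [AddCommMonoid M] [Algebra R A] [Module A M] [Module R M] (s : Finset ι)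
    (D : ι → Derivation R A M) (x : A) : (∑ i ∈ s, D i) x = ∑ i ∈ s, D i x := by
  rw [← Derivation.coeFnAddMonoidHom_apply, map_sum, Finset.sum_apply]
  rfl

/-- The Leibniz rule for finite products. -/
theorem Derivation.leibniz_finset_prod {ι R A : Type*} [DecidableEq ι] [CommRing R] [CommRing A]
    [Algebra R A] (D : Derivation R A A) (s : Finset ι) (f : ι → A) :
    D (∏ i ∈ s, f i) = ∑ i ∈ s, D (f i) * ∏ j ∈ s.erase i, f j := by
  induction s using Finset.induction_on with
  | empty => simp
  | insert b s hb ih =>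
    rw [Finset.prod_insert hb, Finset.sum_insert hb, D.leibniz, ih, Finset.erase_insert hb,
      smul_eq_mul, smul_eq_mul, Finset.mul_sum, add_comm, mul_comm (∏ i ∈ s, f i)]
    congr 1
    refine Finset.sum_congr rfl fun i hi => ?_
    have hib : b ≠ i := fun e => hb (e ▸ hi)
    rw [Finset.erase_insert_of_ne hib,
      Finset.prod_insert fun hm => hb (Finset.mem_of_mem_erase hm)]
    ring

/-- Jacobi's formula for a derivation applied to a determinant. -/
theorem Derivation.apply_det {ι R A : Type*} [Fintype ι] [DecidableEq ι] [CommRing R] [CommRing A]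
    [Algebra R A] (D : Derivation R A A) (M : Matrix ι ι A) :
    D M.det = (M.adjugate * M.map D).trace := by
  have hcol (i : ι) : (M.adjugate * M.map D) i i = (M.updateCol i fun k => D (M k i)).det := by
    rw [← Matrix.cramer_apply, Matrix.cramer_eq_adjugate_mulVec]
    rfl
  simp only [Matrix.trace, Matrix.diag_apply, hcol, Matrix.det_apply, map_sum]
  rw [Finset.sum_comm]
  refine Finset.sum_congr rfl fun σ _ => ?_
  rw [Units.smul_def, map_zsmul, D.leibniz_finset_prod, Finset.smul_sum]
  refine Finset.sum_congr rfl fun i _ => ?_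
  rw [Units.smul_def, ← Finset.mul_prod_erase _ _ (Finset.mem_univ i), Matrix.updateCol_self]
  congr 2
  refine Finset.prod_congr rfl fun j hj => ?_
  rw [Matrix.updateCol_ne (Finset.ne_of_mem_erase hj)]

/-- If `D` acts on a square matrix `M` as `C * M + M * B`, then `D` preserves the ideal
generated by `det M`. -/
theorem Derivation.det_dvd_apply_det {ι R A : Type*} [Fintype ι] [DecidableEq ι] [CommRing R]
    [CommRing A] [Algebra R A] (D : Derivation R A A) {M B C : Matrix ι ι A}
    (h : M.map D = C * M + M * B) : M.det ∣ D M.det := by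
  refine ⟨C.trace + B.trace, ?_⟩
  rw [D.apply_det, h, mul_add, Matrix.trace_add, ← mul_assoc M.adjugate M B, Matrix.adjugate_mul,
    Matrix.trace_mul_comm, mul_assoc, Matrix.mul_adjugate]
  simp [mul_add]

/-- Relative Saito lemma, first assertion (Lemma 3.20 of the paper): if the relative vector
fields `δᵢ = ∑ⱼ aᵢⱼ ∂/∂xⱼ` on `ℂ[x₁,…,xₙ,t₁,…,t_r]` are closed under Lie bracket, then each
`δₖ` preserves the ideal generated by `h = det (aᵢⱼ)`. -/
theorem relative_saito_det_logarithmic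
    (n r : ℕ) (a : Fin n → Fin n → MvPolynomial (Fin n ⊕ Fin r) ℂ)
    (δ : Fin n → Derivation ℂ (MvPolynomial (Fin n ⊕ Fin r) ℂ)
      (MvPolynomial (Fin n ⊕ Fin r) ℂ))
    (hδ : ∀ i, δ i = ∑ j, a i j • pderiv (Sum.inl j))
    (hclosed : ∀ i j, ⁅δ i, δ j⁆ ∈
      Submodule.span (MvPolynomial (Fin n ⊕ Fin r) ℂ) (Set.range δ))
    (h : MvPolynomial (Fin n ⊕ Fin r) ℂ) (hh : h = (Matrix.of a).det) :
    ∀ k, δ k h ∈ Ideal.span {h} := by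
  intro k
  have hX (i j : Fin n) : δ i (X (Sum.inl j)) = a i j := by
    simp [hδ, Derivation.finset_sum_apply, pderiv_X, Pi.single_apply]
  choose c hc using fun i => (Submodule.mem_span_range_iff_exists_fun _).mp (hclosed k i)
  rw [Ideal.mem_span_singleton, hh]
  refine (δ k).det_dvd_apply_det (C := Matrix.of c)
    (B := Matrix.of fun l j => pderiv (Sum.inl l) (a k j)) ?_
  ext1 i j
  have hbracket := DFunLike.congr_fun (hc i) (X (Sum.inl j))
  have hδa : δ i (a k j) = ∑ l, a i l * pderiv (Sum.inl l) (a k j) := by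
    simp [hδ, Derivation.finset_sum_apply]
  simp only [Derivation.finset_sum_apply, Derivation.smul_apply, Derivation.commutator_apply, hX,
    smul_eq_mul] at hbracket
  simp only [Matrix.map_apply, Matrix.add_apply, Matrix.mul_apply, Matrix.of_apply]
  rw [hbracket, ← hδa, sub_add_cancel]
end

section
/- For all i, j ∈ Fin n, the matrix identity δᵢ(C_j) − δ_j(Cᵢ) + (C_j·Cᵢ − Cᵢ·C_j) = ∑ₖ (b i j k) • Cₖ holds if and only if ∑ₖ (a k r)·∂ₗ(b i j k) = 0 for all l, r ∈ Fin n. -/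
open MvPolynomial

/-- A finite sum of derivations is evaluated termwise. -/
theorem derivation_sum_apply {R A M ι : Type*} [CommSemiring R] [CommSemiring A]
    [AddCommMonoid M] [Algebra R A] [Module A M] [Module R M] (s : Finset ι)
    (D : ι → Derivation R A M) (x : A) : (∑ k ∈ s, D k) x = ∑ k ∈ s, D k x := by
  classical
  induction s using Finset.induction_on with
  | empty => simp
  | insert k s hk ih => simp [Finset.sum_insert hk, ih]

/-- The partial derivatives of a polynomial ring commute. -/
theorem pderiv_pderiv_comm {R σ : Type*} [CommRing R] (l m : σ) (f : MvPolynomial σ R) :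
    pderiv l (pderiv m f) = pderiv m (pderiv l f) := by
  classical
  have h : ⁅pderiv (R := R) l, pderiv (R := R) m⁆ = 0 := by
    ext1 s
    simp [Derivation.commutator_apply, pderiv_X, Pi.single_apply, apply_ite]
  simpa [Derivation.commutator_apply, sub_eq_zero] using DFunLike.congr_fun h f

/-- A partial derivative of `δ f`, for the vector field `δ = ∑ₘ cₘ ∂ₘ`. -/
theorem pderiv_vectorField_apply {R σ : Type*} [CommRing R] [Fintype σ]
    (c : σ → MvPolynomial σ R) (l : σ) (f : MvPolynomial σ R) :
    pderiv l ((∑ m, c m • pderiv m : Derivation R (MvPolynomial σ R) (MvPolynomial σ R)) f) =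
      ∑ m, pderiv l (c m) * pderiv m f +
        (∑ m, c m • pderiv m : Derivation R (MvPolynomial σ R) (MvPolynomial σ R)) (pderiv l f) := by
  simp only [derivation_sum_apply, Derivation.smul_apply, smul_eq_mul, map_sum,
    Derivation.leibniz, ← Finset.sum_add_distrib]
  refine Finset.sum_congr rfl fun m _ => ?_
  rw [pderiv_pderiv_comm l m]
  ring

/-- The value of the vector field `∑ₘ cₘ ∂ₘ` at a coordinate function. -/
theorem vectorField_apply_X {R σ : Type*} [CommRing R] [Fintype σ]
    (c : σ → MvPolynomial σ R) (r : σ) :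
    (∑ m, c m • pderiv m : Derivation R (MvPolynomial σ R) (MvPolynomial σ R)) (X r) = c r := by
  classical
  simp [derivation_sum_apply, pderiv_X, Pi.single_apply]

/-- Lemma 4.17 of the paper: integrability condition for the logarithmic connection on
`Der_{ℂⁿ}`.  With `δᵢ = ∑ⱼ aᵢⱼ ∂ⱼ`, `⁅δᵢ,δⱼ⁆ = ∑ₖ bᵢⱼₖ δₖ` and `(Cᵢ)ⱼₖ = −∂ⱼ(aᵢₖ)`, the
matrix identity `δᵢ(C_j) − δ_j(Cᵢ) + [C_j, Cᵢ] = ∑ₖ bᵢⱼₖ Cₖ` holds iff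
`∑ₖ aₖᵣ ∂ₗ(bᵢⱼₖ) = 0` for all `l, r`. -/
theorem integrability_connection_der
    (n : ℕ) (a : Fin n → Fin n → MvPolynomial (Fin n) ℂ)
    (b : Fin n → Fin n → Fin n → MvPolynomial (Fin n) ℂ)
    (δ : Fin n → Derivation ℂ (MvPolynomial (Fin n) ℂ) (MvPolynomial (Fin n) ℂ))
    (hδ : ∀ i, δ i = ∑ j, a i j • pderiv j)
    (hb : ∀ i j, ⁅δ i, δ j⁆ = ∑ k, b i j k • δ k)
    (C : Fin n → Matrix (Fin n) (Fin n) (MvPolynomial (Fin n) ℂ))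
    (hC : ∀ i, C i = Matrix.of fun j k => -(pderiv j (a i k)))
    (i j : Fin n) :
    ((C j).map (δ i) - (C i).map (δ j) + (C j * C i - C i * C j)
        = ∑ k, b i j k • C k)
      ↔ (∀ l r, ∑ k, a k r * pderiv l (b i j k) = 0) := by
  have hδX (k r) : δ k (X r) = a k r := by rw [hδ, vectorField_apply_X]
  have hpδ (k l f) : pderiv l (δ k f) =
      ∑ m, pderiv l (a k m) * pderiv m f + δ k (pderiv l f) := by
    rw [hδ, pderiv_vectorField_apply]
  have hbX (r) : δ i (a j r) - δ j (a i r) = ∑ k, b i j k * a k r := by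
    simpa [Derivation.commutator_apply, derivation_sum_apply, hδX] using
      DFunLike.congr_fun (hb i j) (X r)
  have key (l r) : ((C j).map (δ i) - (C i).map (δ j) + (C j * C i - C i * C j)) l r -
      (∑ k, b i j k • C k) l r = -∑ k, a k r * pderiv l (b i j k) := by
    have h := congrArg (pderiv l) (hbX r)
    simp only [map_sub, hpδ, map_sum, Derivation.leibniz, smul_eq_mul,
      Finset.sum_add_distrib] at h
    simp only [hC, Matrix.add_apply, Matrix.sub_apply, Matrix.map_apply, Matrix.of_apply,
      Matrix.mul_apply, Matrix.sum_apply, Matrix.smul_apply, smul_eq_mul, map_neg, neg_mul,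
      mul_neg, neg_neg, Finset.sum_neg_distrib]
    linear_combination -h
  rw [← Matrix.ext_iff]
  refine forall₂_congr fun l r => ?_
  rw [← sub_eq_zero, key, neg_eq_zero]
end

section
/- Let f = x³y − xy³ = x·y·(x−y)·(x+y) ∈ ℂ[x,y]. Then x²y² ∉ Ideal.span {∂f/∂x, ∂f/∂y} = Ideal.span {3x²y − y³, x³ − 3xy²}. (Hence the infinitesimal admissible deformation V(f + ε·x²y²) of the free divisor germ V(f) ⊂ (ℂ²,0) is non-trivial, so FT¹(V(f)) ≠ 0.) -/
open MvPolynomial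

/-- The value at the origin of the bilaplacian `(∂ₓ² + ∂ᵧ²)² p`. -/
noncomputable def bilaplacianAtZero (p : MvPolynomial (Fin 2) ℂ) : ℂ :=
  eval 0 (pderiv 0 (pderiv 0 (pderiv 0 (pderiv 0 p)))
    + 2 * pderiv 1 (pderiv 1 (pderiv 0 (pderiv 0 p)))
    + pderiv 1 (pderiv 1 (pderiv 1 (pderiv 1 p))))

theorem bilaplacianAtZero_add (p q : MvPolynomial (Fin 2) ℂ) :
    bilaplacianAtZero (p + q) = bilaplacianAtZero p + bilaplacianAtZero q := by
  simp only [bilaplacianAtZero, map_add, map_mul]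
  ring

theorem pderiv_ofNat {σ R : Type*} [CommSemiring R] (i : σ) (n : ℕ) [n.AtLeastTwo] :
    pderiv i (ofNat(n) : MvPolynomial σ R) = 0 :=
  (pderiv i).map_natCast n

theorem constantCoeff_ofNat {σ R : Type*} [CommSemiring R] (n : ℕ) [n.AtLeastTwo] :
    constantCoeff (ofNat(n) : MvPolynomial σ R) = ofNat(n) :=
  map_ofNat constantCoeff n

theorem bilaplacianAtZero_mul_fst (p : MvPolynomial (Fin 2) ℂ) :
    bilaplacianAtZero (p * (3 * X 0 ^ 2 * X 1 - X 1 ^ 3)) = 0 := by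
  simp [bilaplacianAtZero, Derivation.leibniz, Derivation.leibniz_pow, pderiv_ofNat,
    constantCoeff_ofNat, pderiv_X]
  ring

theorem bilaplacianAtZero_mul_snd (p : MvPolynomial (Fin 2) ℂ) :
    bilaplacianAtZero (p * (X 0 ^ 3 - 3 * X 0 * X 1 ^ 2)) = 0 := by
  simp [bilaplacianAtZero, Derivation.leibniz, Derivation.leibniz_pow, pderiv_ofNat,
    constantCoeff_ofNat, pderiv_X]
  ring

theorem bilaplacianAtZero_sq_mul_sq :
    bilaplacianAtZero (X 0 ^ 2 * X 1 ^ 2) = 8 := by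
  simp [bilaplacianAtZero, Derivation.leibniz, Derivation.leibniz_pow, pderiv_ofNat,
    constantCoeff_ofNat, pderiv_X]
  norm_num

/-- For `f = x³y − xy³ = xy(x−y)(x+y)`, the monomial `x²y²` does not lie in the Jacobian
ideal `J(f) = (3x²y − y³, x³ − 3xy²)`; hence the infinitesimal admissible deformation
`V(f + ε x²y²)` is non-trivial and `FT¹(V(f)) ≠ 0`. -/
theorem x2y2_not_mem_jacobian_ideal :
    (Ideal.span {pderiv 0 (X 0 ^ 3 * X 1 - X 0 * X 1 ^ 3 : MvPolynomial (Fin 2) ℂ),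
        pderiv 1 (X 0 ^ 3 * X 1 - X 0 * X 1 ^ 3 : MvPolynomial (Fin 2) ℂ)}
      = Ideal.span {(3 : MvPolynomial (Fin 2) ℂ) * X 0 ^ 2 * X 1 - X 1 ^ 3,
          X 0 ^ 3 - (3 : MvPolynomial (Fin 2) ℂ) * X 0 * X 1 ^ 2})
    ∧ (X 0 ^ 2 * X 1 ^ 2 : MvPolynomial (Fin 2) ℂ) ∉
        Ideal.span {pderiv 0 (X 0 ^ 3 * X 1 - X 0 * X 1 ^ 3 : MvPolynomial (Fin 2) ℂ),
          pderiv 1 (X 0 ^ 3 * X 1 - X 0 * X 1 ^ 3 : MvPolynomial (Fin 2) ℂ)} := by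
  have fst_eq : pderiv 0 (X 0 ^ 3 * X 1 - X 0 * X 1 ^ 3 : MvPolynomial (Fin 2) ℂ)
      = 3 * X 0 ^ 2 * X 1 - X 1 ^ 3 := by
    simp [Derivation.leibniz, Derivation.leibniz_pow, pderiv_X]
    ring
  have snd_eq : pderiv 1 (X 0 ^ 3 * X 1 - X 0 * X 1 ^ 3 : MvPolynomial (Fin 2) ℂ)
      = X 0 ^ 3 - 3 * X 0 * X 1 ^ 2 := by
    simp [Derivation.leibniz, Derivation.leibniz_pow, pderiv_X]
    ring
  rw [fst_eq, snd_eq]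
  refine ⟨rfl, fun mem => ?_⟩
  obtain ⟨a, b, hab⟩ := Ideal.mem_span_pair.1 mem
  have value := bilaplacianAtZero_sq_mul_sq
  rw [← hab, bilaplacianAtZero_add, bilaplacianAtZero_mul_fst, bilaplacianAtZero_mul_snd] at value
  norm_num at value
end

section
/- In ℂ[x₁,…,x₅], let f = x₅·(x₄⁴ − 2x₅x₄²x₃ + x₅²x₃² + 2x₅²x₄x₂ − 2x₅³x₁). Then x₄⁴·x₅ ∉ Ideal.span {∂f/∂x₁, ∂f/∂x₂, ∂f/∂x₃, ∂f/∂x₄, ∂f/∂x₅}. (Hence the infinitesimal linearly admissible deformation V(f + ε·x₄⁴x₅) of this non-reductive linear free divisor is non-trivial, so LFT¹ ≠ 0: reductivity cannot be dropped in the rigidity theorem.) -/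
open MvPolynomial

/-- Brian Pike's example: for the non-reductive linear free divisor in `ℂ⁵` defined by
`f = x₅(x₄⁴ − 2x₅x₄²x₃ + x₅²x₃² + 2x₅²x₄x₂ − 2x₅³x₁)`, the monomial `x₄⁴x₅` does not lie
in the Jacobian ideal of `f`; hence the infinitesimal linearly admissible deformation
`V(f + ε x₄⁴x₅)` is non-trivial and `LFT¹ ≠ 0`. -/
theorem x4pow4_x5_not_mem_jacobian_ideal :
    letI f : MvPolynomial (Fin 5) ℂ :=
      X 4 * (X 3 ^ 4 - 2 * X 4 * X 3 ^ 2 * X 2 + X 4 ^ 2 * X 2 ^ 2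
        + 2 * X 4 ^ 2 * X 3 * X 1 - 2 * X 4 ^ 3 * X 0)
    (X 3 ^ 4 * X 4 : MvPolynomial (Fin 5) ℂ) ∉
      Ideal.span {pderiv 0 f, pderiv 1 f, pderiv 2 f, pderiv 3 f, pderiv 4 f} := by
  intro h
  -- Restrict to the curve `s ↦ (0, 0, 1, s, s²)`, along which the Jacobian ideal lands in `(s⁷)`.
  let φ : MvPolynomial (Fin 5) ℂ →ₐ[ℂ] Polynomial ℂ :=
    aeval ![0, 0, 1, Polynomial.X, Polynomial.X ^ 2]
  have hφ : φ (X 3 ^ 4 * X 4) = Polynomial.X ^ 6 := by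
    simp [φ]
    ring
  have hle := Ideal.span_le (I := (Ideal.span {(Polynomial.X : Polynomial ℂ) ^ 7}).comap φ).2 ?_ h
  · rw [Ideal.mem_comap, hφ, Ideal.mem_span_singleton, Polynomial.X_pow_dvd_iff] at hle
    simpa using hle 6 (by norm_num)
  · have h2 (i : Fin 5) : pderiv i (2 : MvPolynomial (Fin 5) ℂ) = 0 :=
      (pderiv i).map_natCast 2
    rintro p (rfl | rfl | rfl | rfl | rfl) <;>
      rw [SetLike.mem_coe, Ideal.mem_comap, Ideal.mem_span_singleton]
    · refine ⟨-2 * Polynomial.X, ?_⟩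
      simp [φ, pderiv_X, h2]
      ring
    · refine ⟨2, ?_⟩
      simp [φ, pderiv_X, h2]
      ring
    all_goals
      refine ⟨0, ?_⟩
      simp [φ, pderiv_X, h2]
      ring
end
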